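/- For j = 1,…,7 let Z_j = {p ∈ ℝ⁷ : p_s = 0 for all s ∈ S_j}, where the seven position sets (positions refer to the coordinates (x₁,x₂,x₃,x₁₂,x₁₃,x₂₃,x₁₂₃) numbered 1–7) are S₁ = {1,2,3,7}, S₂ = {1,2,5,6}, S₃ = {1,3,4,6}, S₄ = {1,4,5,7}, S₅ = {2,3,4,5}, S₆ = {2,4,6,7}, S₇ = {3,5,6,7}. Then the map U sends each Z_j bijectively onto Z_{τ_U(j)} with τ_U = (1 5)(2 6); Q sends each Z_j bijectively onto Z_{τ_Q(j)} with τ_Q = (2 3 5)(4 7 6); P sends each Z_j bijectively onto Z_{τ_P(j)} with τ_P = (3 5)(4 6); and S sends each Z_j bijectively onto itself. -/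

import Mathlib

noncomputable section

/-- Coordinates on `ℝ⁷` are `(x₁,x₂,x₃,x₁₂,x₁₃,x₂₃,x₁₂₃)`, numbered `1,…,7`
in the text and indexed `0,…,6` here. -/
abbrev R7 := Fin 7 → ℝ

def U (p : R7) : R7 :=
  ![p 3, p 1, p 2, 2 * p 1 * p 3 - p 0, p 6, p 5, 2 * p 1 * p 6 - p 4]

def Q (p : R7) : R7 :=
  ![p 1, p 2, p 0, p 5, p 3, p 4, p 6]

def S (p : R7) : R7 :=
  ![p 0, p 1, p 2, 2 * p 0 * p 1 - p 3, 2 * p 0 * p 2 - p 4, p 5,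
    2 * p 0 * p 5 - p 6]

def P (p : R7) : R7 :=
  ![p 1, p 0, p 2, p 3, p 5, p 4,
    -4 * p 0 * p 1 * p 2 + 2 * p 0 * p 5 + 2 * p 1 * p 4 + 2 * p 2 * p 3 - p 6]

/-- The seven position sets `S₁,…,S₇` (1-indexed positions `{1,2,3,7}` etc.
become 0-indexed `{0,1,2,6}` etc.). -/
def SS : Fin 7 → Finset (Fin 7) :=
  ![{0, 1, 2, 6}, {0, 1, 4, 5}, {0, 2, 3, 5}, {0, 3, 4, 6},
    {1, 2, 3, 4}, {1, 3, 5, 6}, {2, 4, 5, 6}]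

/-- `Z_j` is the set of points of `ℝ⁷` vanishing at all positions in `S_j`. -/
def Z (j : Fin 7) : Set R7 := {p | ∀ s ∈ SS j, p s = 0}

/-- `τ_U = (1 5)(2 6)` on positions `1,…,7`, in 0-indexed form. -/
def tauU : Fin 7 → Fin 7 := ![4, 5, 2, 3, 0, 1, 6]

/-- `τ_Q = (2 3 5)(4 7 6)` on positions `1,…,7`, in 0-indexed form. -/
def tauQ : Fin 7 → Fin 7 := ![0, 2, 4, 6, 1, 3, 5]

/-- `τ_P = (3 5)(4 6)` on positions `1,…,7`, in 0-indexed form. -/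
def tauP : Fin 7 → Fin 7 := ![0, 1, 4, 5, 2, 3, 6]

def Uinv (y : R7) : R7 :=
  ![2 * y 1 * y 0 - y 3, y 1, y 2, y 0, 2 * y 1 * y 4 - y 6, y 5, y 4]

def Qinv (y : R7) : R7 :=
  ![y 2, y 0, y 1, y 4, y 5, y 3, y 6]

/-- A map with a two-sided inverse respecting the sets is a bijection between them. -/
theorem bijOn_of_inv {f g : R7 → R7} {s t : Set R7} (h1 : ∀ p, g (f p) = p)
    (h2 : ∀ p, f (g p) = p) (hf : ∀ p ∈ s, f p ∈ t) (hg : ∀ p ∈ t, g p ∈ s) :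
    Set.BijOn f s t :=
  Set.InvOn.bijOn ⟨fun p _ => h1 p, fun p _ => h2 p⟩ hf hg

theorem stmt10 :
    (∀ j : Fin 7, Set.BijOn U (Z j) (Z (tauU j))) ∧
    (∀ j : Fin 7, Set.BijOn Q (Z j) (Z (tauQ j))) ∧
    (∀ j : Fin 7, Set.BijOn P (Z j) (Z (tauP j))) ∧
    (∀ j : Fin 7, Set.BijOn S (Z j) (Z j)) := by
  refine ⟨?_, ?_, ?_, ?_⟩
  · intro j
    apply bijOn_of_inv (g := Uinv)
    · intro p; ext i; fin_cases i <;> simp [U, Uinv] <;> try ring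
    · intro p; ext i; fin_cases i <;> simp [U, Uinv] <;> try ring
    · fin_cases j <;> simp +contextual [Z, SS, U, tauU]
    · fin_cases j <;> simp +contextual [Z, SS, Uinv, tauU]
  · intro j
    apply bijOn_of_inv (g := Qinv)
    · intro p; ext i; fin_cases i <;> simp [Q, Qinv] <;> try ring
    · intro p; ext i; fin_cases i <;> simp [Q, Qinv] <;> try ring
    · fin_cases j <;> simp +contextual [Z, SS, Q, tauQ]
    · fin_cases j <;> simp +contextual [Z, SS, Qinv, tauQ]
  · intro j
    apply bijOn_of_inv (g := P)
    · intro p; ext i; fin_cases i <;> simp [P, P] <;> try ring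
    · intro p; ext i; fin_cases i <;> simp [P, P] <;> try ring
    · fin_cases j <;> simp +contextual [Z, SS, P, tauP]
    · fin_cases j <;> simp +contextual [Z, SS, P, tauP]
  · intro j
    apply bijOn_of_inv (g := S)
    · intro p; ext i; fin_cases i <;> simp [S, S] <;> try ring
    · intro p; ext i; fin_cases i <;> simp [S, S] <;> try ring
    · fin_cases j <;> simp +contextual [Z, SS, S]
    · fin_cases j <;> simp +contextual [Z, SS, S]


end
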